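/- Let Ω ⊂ ℝ² be a bounded simply connected open set whose boundary is a polygon consisting of finitely many disjoint open straight segments A₁,…,A_k and B₁,…,B_l together with their endpoints (the vertices), with no other boundary arcs. Let u₁ and u₂ be C² solutions of the minimal surfaces equation in Ω such that, for i = 1,2, uᵢ → +∞ on each A_j and uᵢ → −∞ on each B_j. Then u₁ − u₂ is a constant function on Ω. -/

import Mathlib

open Real Filter Set Topology MeasureTheory

/-- Partial derivative in the first (x) variable. -/
noncomputable def pd1 (u : ℝ × ℝ → ℝ) (z : ℝ × ℝ) : ℝ := deriv (fun t => u (t, z.2)) z.1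

/-- Partial derivative in the second (y) variable. -/
noncomputable def pd2 (u : ℝ × ℝ → ℝ) (z : ℝ × ℝ) : ℝ := deriv (fun t => u (z.1, t)) z.2

/-- `W = √(1 + p² + q²)` for the function `u`. -/
noncomputable def Wg (u : ℝ × ℝ → ℝ) (z : ℝ × ℝ) : ℝ :=
  Real.sqrt (1 + pd1 u z ^ 2 + pd2 u z ^ 2)

/-- `u` is a C² solution of the minimal surfaces equation
`(1+q²)r − 2pq·s + (1+p²)t = 0` on `Ω`. -/
def IsMSE (u : ℝ × ℝ → ℝ) (Ω : Set (ℝ × ℝ)) : Prop :=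
  ContDiffOn ℝ 2 u Ω ∧ ∀ z ∈ Ω,
    (1 + pd2 u z ^ 2) * pd1 (pd1 u) z
      - 2 * pd1 u z * pd2 u z * pd2 (pd1 u) z
      + (1 + pd1 u z ^ 2) * pd2 (pd2 u) z = 0

/-- Euclidean length of a planar vector. -/
noncomputable def len (v : ℝ × ℝ) : ℝ := Real.sqrt (v.1 ^ 2 + v.2 ^ 2)

/-- Euclidean open disk in the plane. -/
def eball (P : ℝ × ℝ) (ρ : ℝ) : Set (ℝ × ℝ) := {z | len (z - P) < ρ}

/-! ### Helpers -/

lemma ind_zero {Ω : Set (ℝ × ℝ)} {f : ℝ × ℝ → ℝ}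
    (h0 : ∀ z, z ∉ Ω → ∀ᶠ z' in 𝓝[Ω] z, f z' = 0) :
    ∀ z, z ∉ Ω → Ω.indicator f =ᶠ[𝓝 z] fun _ => 0 := by
  intro z hz
  have := eventually_nhdsWithin_iff.1 (h0 z hz)
  filter_upwards [this] with y hy
  by_cases h : y ∈ Ω
  · simp [h, hy h]
  · simp [h]

lemma ind_eq {Ω : Set (ℝ × ℝ)} (hΩ : IsOpen Ω) {f : ℝ × ℝ → ℝ} :
    ∀ z ∈ Ω, Ω.indicator f =ᶠ[𝓝 z] f := by
  intro z hz
  filter_upwards [hΩ.mem_nhds hz] with y hy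
  simp [hy]

lemma ind_contDiff {Ω : Set (ℝ × ℝ)} (hΩ : IsOpen Ω) {n : WithTop ℕ∞} {f : ℝ × ℝ → ℝ}
    (hf : ContDiffOn ℝ n f Ω) (h0 : ∀ z, z ∉ Ω → ∀ᶠ z' in 𝓝[Ω] z, f z' = 0) :
    ContDiff ℝ n (Ω.indicator f) := by
  rw [contDiff_iff_contDiffAt]
  intro z
  by_cases hz : z ∈ Ω
  · exact (hf.contDiffAt (hΩ.mem_nhds hz)).congr_of_eventuallyEq (ind_eq hΩ z hz)
  · exact contDiffAt_const.congr_of_eventuallyEq (ind_zero h0 z hz)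

lemma ind_compact {Ω : Set (ℝ × ℝ)} (hb : Bornology.IsBounded Ω) (f : ℝ × ℝ → ℝ) :
    HasCompactSupport (Ω.indicator f) := by
  refine HasCompactSupport.intro (K := closure Ω) hb.isCompact_closure ?_
  intro x hx
  exact Set.indicator_of_notMem (fun h => hx (subset_closure h)) _

lemma van_integrableOn {Ω : Set (ℝ × ℝ)} (hΩ : IsOpen Ω) (hb : Bornology.IsBounded Ω)
    {f : ℝ × ℝ → ℝ}
    (hf : ContinuousOn f Ω) (h0 : ∀ z, z ∉ Ω → ∀ᶠ z' in 𝓝[Ω] z, f z' = 0) :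
    IntegrableOn f Ω := by
  rw [← integrable_indicator_iff hΩ.measurableSet]
  have := ind_contDiff (n := 0) hΩ (contDiffOn_zero.2 hf) h0
  exact this.continuous.integrable_of_hasCompactSupport (ind_compact hb f)

lemma integral_fderiv_zero {F : ℝ × ℝ → ℝ} (hF : ContDiff ℝ 1 F) (hc : HasCompactSupport F)
    (v : ℝ × ℝ) : ∫ z, fderiv ℝ F z v = 0 := by
  have hd : Continuous fun z => fderiv ℝ F z v :=
    (hF.continuous_fderiv (by norm_num)).clm_apply continuous_const
  have h := integral_mul_fderiv_eq_neg_fderiv_mul_of_integrable (μ := (volume : Measure (ℝ × ℝ)))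
    (f := fun _ => (1 : ℝ)) (g := F) (v := v) (by simp)
    (by simpa using hd.integrable_of_hasCompactSupport (hc.fderiv_apply ℝ v))
    (by simpa using hF.continuous.integrable_of_hasCompactSupport hc)
    (fun x _ => differentiableAt_const _) (fun x _ => hF.differentiable (by norm_num) x)
  simpa using h

/-- divergence-type integral over `Ω` of a derivative vanishes -/
lemma van_integral_fderiv {Ω : Set (ℝ × ℝ)} (hΩ : IsOpen Ω) (hb : Bornology.IsBounded Ω)
    {f : ℝ × ℝ → ℝ}
    (hf : ContDiffOn ℝ 1 f Ω) (h0 : ∀ z, z ∉ Ω → ∀ᶠ z' in 𝓝[Ω] z, f z' = 0) (v : ℝ × ℝ) :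
    IntegrableOn (fun z => fderiv ℝ f z v) Ω ∧ ∫ z in Ω, fderiv ℝ f z v = 0 := by
  have hC := ind_contDiff hΩ hf h0
  have hcs := ind_compact hb f
  have hI := integral_fderiv_zero hC hcs v
  have heq : (fun z => fderiv ℝ (Ω.indicator f) z v) = Ω.indicator (fun z => fderiv ℝ f z v) := by
    funext z
    by_cases hz : z ∈ Ω
    · simp [hz, (ind_eq hΩ z hz (f := f)).fderiv_eq]
    · simp [hz, (ind_zero h0 z hz).fderiv_eq]
  have hd : Continuous fun z => fderiv ℝ (Ω.indicator f) z v :=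
    (hC.continuous_fderiv (by norm_num)).clm_apply continuous_const
  constructor
  · rw [← integrable_indicator_iff hΩ.measurableSet, ← heq]
    exact hd.integrable_of_hasCompactSupport (hcs.fderiv_apply ℝ v)
  · rw [heq, integral_indicator hΩ.measurableSet] at hI
    exact hI

lemma pd1_eq {u : ℝ × ℝ → ℝ} {z : ℝ × ℝ} (h : DifferentiableAt ℝ u z) :
    pd1 u z = fderiv ℝ u z (1, 0) := by
  have h1 : HasDerivAt (fun t : ℝ => (t, z.2)) ((1 : ℝ), (0 : ℝ)) z.1 :=
    (hasDerivAt_id z.1).prodMk (hasDerivAt_const z.1 z.2)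
  exact (HasFDerivAt.comp_hasDerivAt (f := fun t : ℝ => (t, z.2)) z.1 h.hasFDerivAt h1).deriv

lemma pd2_eq {u : ℝ × ℝ → ℝ} {z : ℝ × ℝ} (h : DifferentiableAt ℝ u z) :
    pd2 u z = fderiv ℝ u z (0, 1) := by
  have h1 : HasDerivAt (fun t : ℝ => (z.1, t)) ((0 : ℝ), (1 : ℝ)) z.2 :=
    (hasDerivAt_const z.2 z.1).prodMk (hasDerivAt_id z.2)
  exact (HasFDerivAt.comp_hasDerivAt (f := fun t : ℝ => (z.1, t)) z.2 h.hasFDerivAt h1).deriv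

lemma pd_c1 {Ω : Set (ℝ × ℝ)} (hΩ : IsOpen Ω) {u : ℝ × ℝ → ℝ} (hu : ContDiffOn ℝ 2 u Ω) :
    ContDiffOn ℝ 1 (pd1 u) Ω ∧ ContDiffOn ℝ 1 (pd2 u) Ω := by
  have hd : ∀ z ∈ Ω, DifferentiableAt ℝ u z := fun z hz =>
    (hu.contDiffAt (hΩ.mem_nhds hz)).differentiableAt (by norm_num)
  have hf : ContDiffOn ℝ 1 (fderiv ℝ u) Ω := hu.fderiv_of_isOpen hΩ (by norm_num)
  constructor
  · exact (hf.clm_apply (contDiffOn_const (c := ((1 : ℝ), (0 : ℝ))))).congr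
      fun z hz => pd1_eq (hd z hz)
  · exact (hf.clm_apply (contDiffOn_const (c := ((0 : ℝ), (1 : ℝ))))).congr
      fun z hz => pd2_eq (hd z hz)

lemma pd_symm {Ω : Set (ℝ × ℝ)} (hΩ : IsOpen Ω) {u : ℝ × ℝ → ℝ} (hu : ContDiffOn ℝ 2 u Ω)
    {z : ℝ × ℝ} (hz : z ∈ Ω) :
    fderiv ℝ (pd2 u) z (1, 0) = fderiv ℝ (pd1 u) z (0, 1) := by
  have hd : ∀ z ∈ Ω, DifferentiableAt ℝ u z := fun z hz =>
    (hu.contDiffAt (hΩ.mem_nhds hz)).differentiableAt (by norm_num)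
  have hf : ContDiffOn ℝ 1 (fderiv ℝ u) Ω := hu.fderiv_of_isOpen hΩ (by norm_num)
  have hfz : DifferentiableAt ℝ (fderiv ℝ u) z :=
    (hf.contDiffAt (hΩ.mem_nhds hz)).differentiableAt (by norm_num)
  have e1 : pd1 u =ᶠ[𝓝 z] fun y => fderiv ℝ u y (1, 0) := by
    filter_upwards [hΩ.mem_nhds hz] with y hy using pd1_eq (hd y hy)
  have e2 : pd2 u =ᶠ[𝓝 z] fun y => fderiv ℝ u y (0, 1) := by
    filter_upwards [hΩ.mem_nhds hz] with y hy using pd2_eq (hd y hy)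
  have hs := (hu.contDiffAt (hΩ.mem_nhds hz)).isSymmSndFDerivAt (by simp)
  rw [e1.fderiv_eq, e2.fderiv_eq, fderiv_clm_apply hfz (by fun_prop),
    fderiv_clm_apply hfz (by fun_prop)]
  simpa using hs.eq (1, 0) (0, 1)

/-- first component of the normalised gradient -/
noncomputable def XX (u : ℝ × ℝ → ℝ) (z : ℝ × ℝ) : ℝ := pd1 u z / Wg u z
/-- second component of the normalised gradient -/
noncomputable def YY (u : ℝ × ℝ → ℝ) (z : ℝ × ℝ) : ℝ := pd2 u z / Wg u z

lemma Wg_pos (u : ℝ × ℝ → ℝ) (z : ℝ × ℝ) : 0 < Wg u z :=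
  Real.sqrt_pos.2 (by positivity)

lemma Wg_sq (u : ℝ × ℝ → ℝ) (z : ℝ × ℝ) : Wg u z ^ 2 = 1 + pd1 u z ^ 2 + pd2 u z ^ 2 :=
  Real.sq_sqrt (by positivity)

lemma Wg_c1 {Ω : Set (ℝ × ℝ)} (hΩ : IsOpen Ω) {u : ℝ × ℝ → ℝ} (hu : ContDiffOn ℝ 2 u Ω) :
    ContDiffOn ℝ 1 (Wg u) Ω := by
  obtain ⟨h1, h2⟩ := pd_c1 hΩ hu
  refine ContDiffOn.sqrt ((contDiffOn_const.add (h1.pow 2)).add (h2.pow 2)) ?_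
  intro z _
  positivity

lemma XX_c1 {Ω : Set (ℝ × ℝ)} (hΩ : IsOpen Ω) {u : ℝ × ℝ → ℝ} (hu : ContDiffOn ℝ 2 u Ω) :
    ContDiffOn ℝ 1 (XX u) Ω ∧ ContDiffOn ℝ 1 (YY u) Ω := by
  obtain ⟨h1, h2⟩ := pd_c1 hΩ hu
  exact ⟨h1.div (Wg_c1 hΩ hu) fun z _ => (Wg_pos u z).ne',
    h2.div (Wg_c1 hΩ hu) fun z _ => (Wg_pos u z).ne'⟩

lemma div_zero_of_MSE {Ω : Set (ℝ × ℝ)} (hΩ : IsOpen Ω) {u : ℝ × ℝ → ℝ} (hu : IsMSE u Ω)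
    {z : ℝ × ℝ} (hz : z ∈ Ω) :
    fderiv ℝ (XX u) z (1, 0) + fderiv ℝ (YY u) z (0, 1) = 0 := by
  obtain ⟨hu2, hm⟩ := hu
  obtain ⟨h1, h2⟩ := pd_c1 hΩ hu2
  have d1 : DifferentiableAt ℝ (pd1 u) z :=
    (h1.contDiffAt (hΩ.mem_nhds hz)).differentiableAt (by norm_num)
  have d2 : DifferentiableAt ℝ (pd2 u) z :=
    (h2.contDiffAt (hΩ.mem_nhds hz)).differentiableAt (by norm_num)
  have dW : DifferentiableAt ℝ (Wg u) z :=
    ((Wg_c1 hΩ hu2).contDiffAt (hΩ.mem_nhds hz)).differentiableAt (by norm_num)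
  have hmz := hm z hz
  rw [pd1_eq d1, pd2_eq d1, pd2_eq d2] at hmz
  have hsym := pd_symm hΩ hu2 hz
  have hW0 := Wg_pos u z
  have hWsq := Wg_sq u z
  -- derivative of W from W^2
  have hWd : ∀ v, Wg u z * fderiv ℝ (Wg u) z v =
      pd1 u z * fderiv ℝ (pd1 u) z v + pd2 u z * fderiv ℝ (pd2 u) z v := by
    intro v
    have hfe : (fun y => Wg u y ^ 2) = fun y => 1 + pd1 u y ^ 2 + pd2 u y ^ 2 :=
      funext fun y => Wg_sq u y
    have a : HasFDerivAt (fun y => Wg u y ^ 2) _ z := dW.hasFDerivAt.pow 2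
    have b : HasFDerivAt (fun y => 1 + pd1 u y ^ 2 + pd2 u y ^ 2) _ z :=
      ((d1.hasFDerivAt.pow 2).const_add 1).add (d2.hasFDerivAt.pow 2)
    rw [hfe] at a
    have key : (2 * Wg u z) * fderiv ℝ (Wg u) z v = (2 * pd1 u z) * fderiv ℝ (pd1 u) z v
        + (2 * pd2 u z) * fderiv ℝ (pd2 u) z v := by
      have := a.unique b
      have := congrArg (fun L => L v) this
      simpa using this
    linarith
  have hXY := XX_c1 hΩ hu2
  have hX : ∀ v, fderiv ℝ (XX u) z v =
      (fderiv ℝ (pd1 u) z v * Wg u z - pd1 u z * fderiv ℝ (Wg u) z v) / Wg u z ^ 2 := by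
    intro v
    have dX : DifferentiableAt ℝ (XX u) z :=
      (hXY.1.contDiffAt (hΩ.mem_nhds hz)).differentiableAt (by norm_num)
    have e : (fun y => XX u y * Wg u y) = pd1 u :=
      funext fun y => div_mul_cancel₀ _ (Wg_pos u y).ne'
    have k := congrArg (fun L : (ℝ × ℝ) →L[ℝ] ℝ => L v) (fderiv_fun_mul dX dW)
    rw [e] at k
    simp only [_root_.add_apply, _root_.smul_apply, smul_eq_mul] at k
    have e2 : XX u z * Wg u z = pd1 u z := congrFun e z
    rw [eq_div_iff (by positivity), k, ← e2]
    ring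
  have hY : ∀ v, fderiv ℝ (YY u) z v =
      (fderiv ℝ (pd2 u) z v * Wg u z - pd2 u z * fderiv ℝ (Wg u) z v) / Wg u z ^ 2 := by
    intro v
    have dX : DifferentiableAt ℝ (YY u) z :=
      (hXY.2.contDiffAt (hΩ.mem_nhds hz)).differentiableAt (by norm_num)
    have e : (fun y => YY u y * Wg u y) = pd2 u :=
      funext fun y => div_mul_cancel₀ _ (Wg_pos u y).ne'
    have k := congrArg (fun L : (ℝ × ℝ) →L[ℝ] ℝ => L v) (fderiv_fun_mul dX dW)
    rw [e] at k
    simp only [_root_.add_apply, _root_.smul_apply, smul_eq_mul] at k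
    have e2 : YY u z * Wg u z = pd2 u z := congrFun e z
    rw [eq_div_iff (by positivity), k, ← e2]
    ring
  rw [hX, hY, ← add_div, div_eq_zero_iff]
  left
  have k1 := hWd (1, 0)
  have k2 := hWd (0, 1)
  rw [hsym] at k1
  apply mul_left_cancel₀ hW0.ne'
  rw [mul_zero]
  linear_combination hmz - pd1 u z * k1 - pd2 u z * k2 + (fderiv ℝ (pd1 u) z (1, 0) + fderiv ℝ (pd2 u) z (0, 1)) * hWsq

lemma ibp {Ω : Set (ℝ × ℝ)} (hΩ : IsOpen Ω) (hb : Bornology.IsBounded Ω)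
    {u : ℝ × ℝ → ℝ} (hu : IsMSE u Ω) {f : ℝ × ℝ → ℝ}
    (hf : ContDiffOn ℝ 1 f Ω) (h0 : ∀ z, z ∉ Ω → ∀ᶠ z' in 𝓝[Ω] z, f z' = 0) :
    IntegrableOn (fun z => fderiv ℝ f z (1, 0) * XX u z + fderiv ℝ f z (0, 1) * YY u z) Ω ∧
    ∫ z in Ω, (fderiv ℝ f z (1, 0) * XX u z + fderiv ℝ f z (0, 1) * YY u z) = 0 := by
  obtain ⟨hX, hY⟩ := XX_c1 hΩ hu.1
  obtain ⟨i1, j1⟩ := van_integral_fderiv hΩ hb (hf.mul hX) (fun z hz => by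
    filter_upwards [h0 z hz] with y hy; simp [hy]) (1, 0)
  obtain ⟨i2, j2⟩ := van_integral_fderiv hΩ hb (hf.mul hY) (fun z hz => by
    filter_upwards [h0 z hz] with y hy; simp [hy]) (0, 1)
  have hsum := integral_add i1 i2
  rw [j1, j2, add_zero] at hsum
  have hEq : EqOn (fun z => fderiv ℝ f z (1, 0) * XX u z + fderiv ℝ f z (0, 1) * YY u z)
      (fun z => fderiv ℝ (fun x => f x * XX u x) z (1, 0) +
        fderiv ℝ (fun x => f x * YY u x) z (0, 1)) Ω := by
    intro z hz
    have df : DifferentiableAt ℝ f z :=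
      (hf.contDiffAt (hΩ.mem_nhds hz)).differentiableAt (by norm_num)
    have dX : DifferentiableAt ℝ (XX u) z :=
      (hX.contDiffAt (hΩ.mem_nhds hz)).differentiableAt (by norm_num)
    have dY : DifferentiableAt ℝ (YY u) z :=
      (hY.contDiffAt (hΩ.mem_nhds hz)).differentiableAt (by norm_num)
    have hdiv := div_zero_of_MSE hΩ hu hz
    have e1 : fderiv ℝ (fun y => f y * XX u y) z = _ := fderiv_fun_mul df dX
    have e2 : fderiv ℝ (fun y => f y * YY u y) z = _ := fderiv_fun_mul df dY
    simp only [e1, e2]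
    simp
    linear_combination (-f z) * hdiv
  exact ⟨(i1.add i2).congr_fun hEq.symm hΩ.measurableSet,
    Eq.trans (setIntegral_congr_fun hΩ.measurableSet hEq) hsum⟩

lemma XX_abs (u : ℝ × ℝ → ℝ) (z : ℝ × ℝ) : |XX u z| ≤ 1 ∧ |YY u z| ≤ 1 := by
  have hW := Wg_pos u z
  have hs := Wg_sq u z
  unfold XX YY
  rw [abs_div, abs_div, abs_of_pos hW, div_le_one hW, div_le_one hW]
  constructor <;> refine abs_le_of_sq_le_sq ?_ hW.le <;> nlinarith [sq_nonneg (pd1 u z), sq_nonneg (pd2 u z)]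

/-- `⟨∇u₁, X₁ - X₂⟩` -/
noncomputable def TT (u₁ u₂ : ℝ × ℝ → ℝ) (z : ℝ × ℝ) : ℝ :=
  pd1 u₁ z * (XX u₁ z - XX u₂ z) + pd2 u₁ z * (YY u₁ z - YY u₂ z)

/-- `⟨∇u₁ - ∇u₂, X₁ - X₂⟩` -/
noncomputable def DD (u₁ u₂ : ℝ × ℝ → ℝ) (z : ℝ × ℝ) : ℝ :=
  (pd1 u₁ z - pd1 u₂ z) * (XX u₁ z - XX u₂ z) + (pd2 u₁ z - pd2 u₂ z) * (YY u₁ z - YY u₂ z)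

/-- `⟨∇ψ, X₁ - X₂⟩` -/
noncomputable def NN (ψ u₁ u₂ : ℝ × ℝ → ℝ) (z : ℝ × ℝ) : ℝ :=
  fderiv ℝ ψ z (1, 0) * (XX u₁ z - XX u₂ z) + fderiv ℝ ψ z (0, 1) * (YY u₁ z - YY u₂ z)

lemma TT_ge (u₁ u₂ : ℝ × ℝ → ℝ) (z : ℝ × ℝ) : -1 ≤ TT u₁ u₂ z := by
  have hW1 := Wg_pos u₁ z
  have hs1 := Wg_sq u₁ z
  have hW2 := Wg_pos u₂ z
  have hs2 := Wg_sq u₂ z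
  unfold TT XX YY
  set p := pd1 u₁ z
  set q := pd2 u₁ z
  set p' := pd1 u₂ z
  set q' := pd2 u₂ z
  set W := Wg u₁ z
  set W' := Wg u₂ z
  have h1 : 1 ≤ W := by nlinarith [sq_nonneg p, sq_nonneg q]
  have hcs : p * p' + q * q' ≤ W * W' := by
    refine abs_le_of_sq_le_sq' ?_ (by positivity) |>.2
    have : (W * W') ^ 2 = (1 + p ^ 2 + q ^ 2) * (1 + p' ^ 2 + q' ^ 2) := by
      rw [mul_pow, hs1, hs2]
    rw [this]
    nlinarith [sq_nonneg (p * q' - q * p'), sq_nonneg p, sq_nonneg q, sq_nonneg p', sq_nonneg q']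
  have e : p * (p / W - p' / W') + q * (q / W - q' / W') =
      (p ^ 2 + q ^ 2) / W - (p * p' + q * q') / W' := by ring
  rw [e]
  have a : (p * p' + q * q') / W' ≤ W := by rw [div_le_iff₀ hW2]; exact hcs
  have b : W - 1 ≤ (p ^ 2 + q ^ 2) / W := by
    rw [le_div_iff₀ hW1]; nlinarith
  linarith

lemma DD_eq (u₁ u₂ : ℝ × ℝ → ℝ) (z : ℝ × ℝ) : DD u₁ u₂ z =
    (Wg u₁ z + Wg u₂ z) / 2 * ((XX u₁ z - XX u₂ z) ^ 2 + (YY u₁ z - YY u₂ z) ^ 2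
      + (1 / Wg u₁ z - 1 / Wg u₂ z) ^ 2) := by
  have hW1 := Wg_pos u₁ z
  have hs1 := Wg_sq u₁ z
  have hW2 := Wg_pos u₂ z
  have hs2 := Wg_sq u₂ z
  have e1 : XX u₁ z * Wg u₁ z = pd1 u₁ z := div_mul_cancel₀ _ hW1.ne'
  have e2 : YY u₁ z * Wg u₁ z = pd2 u₁ z := div_mul_cancel₀ _ hW1.ne'
  have e3 : 1 / Wg u₁ z * Wg u₁ z = 1 := div_mul_cancel₀ _ hW1.ne'
  have f1 : XX u₂ z * Wg u₂ z = pd1 u₂ z := div_mul_cancel₀ _ hW2.ne'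
  have f2 : YY u₂ z * Wg u₂ z = pd2 u₂ z := div_mul_cancel₀ _ hW2.ne'
  have f3 : 1 / Wg u₂ z * Wg u₂ z = 1 := div_mul_cancel₀ _ hW2.ne'
  rw [← e1, ← e2] at hs1
  rw [← f1, ← f2] at hs2
  unfold DD
  rw [← e1, ← e2, ← f1, ← f2]
  generalize XX u₁ z = a at *
  generalize YY u₁ z = b at *
  generalize 1 / Wg u₁ z = c at *
  generalize XX u₂ z = a' at *
  generalize YY u₂ z = b' at *
  generalize 1 / Wg u₂ z = c' at *
  generalize Wg u₁ z = W at *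
  generalize Wg u₂ z = W' at *
  have g1 : a ^ 2 + b ^ 2 + c ^ 2 = 1 := by
    apply mul_left_cancel₀ (pow_pos hW1 2).ne'
    linear_combination -hs1 + (c * W + 1) * e3
  have g2 : a' ^ 2 + b' ^ 2 + c' ^ 2 = 1 := by
    apply mul_left_cancel₀ (pow_pos hW2 2).ne'
    linear_combination -hs2 + (c' * W' + 1) * f3
  linear_combination (W - W') / 2 * g1 + (W' - W) / 2 * g2 + (c' - c) * e3 + (c - c') * f3

lemma DD_nonneg (u₁ u₂ : ℝ × ℝ → ℝ) (z : ℝ × ℝ) : 0 ≤ DD u₁ u₂ z := by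
  have hW1 := Wg_pos u₁ z
  have hW2 := Wg_pos u₂ z
  rw [DD_eq]; positivity

lemma DD_zero {u₁ u₂ : ℝ × ℝ → ℝ} {z : ℝ × ℝ} (h : DD u₁ u₂ z = 0) :
    pd1 u₁ z = pd1 u₂ z ∧ pd2 u₁ z = pd2 u₂ z := by
  have hW1 := Wg_pos u₁ z
  have hW2 := Wg_pos u₂ z
  rw [DD_eq, mul_eq_zero] at h
  rcases h with h | h
  · linarith
  have a : XX u₁ z - XX u₂ z = 0 := by
    rw [← sq_eq_zero_iff]; nlinarith [sq_nonneg (XX u₁ z - XX u₂ z), sq_nonneg (YY u₁ z - YY u₂ z), sq_nonneg (1 / Wg u₁ z - 1 / Wg u₂ z)]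
  have b : YY u₁ z - YY u₂ z = 0 := by
    rw [← sq_eq_zero_iff]; nlinarith [sq_nonneg (XX u₁ z - XX u₂ z), sq_nonneg (YY u₁ z - YY u₂ z), sq_nonneg (1 / Wg u₁ z - 1 / Wg u₂ z)]
  have c : 1 / Wg u₁ z - 1 / Wg u₂ z = 0 := by
    rw [← sq_eq_zero_iff]; nlinarith [sq_nonneg (XX u₁ z - XX u₂ z), sq_nonneg (YY u₁ z - YY u₂ z), sq_nonneg (1 / Wg u₁ z - 1 / Wg u₂ z)]
  have hw : Wg u₁ z = Wg u₂ z := by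
    have := sub_eq_zero.1 c
    simpa using this
  unfold XX at a
  unfold YY at b
  rw [hw] at a b
  constructor
  · have := sub_eq_zero.1 a
    rwa [div_left_inj' hW2.ne'] at this
  · have := sub_eq_zero.1 b
    rwa [div_left_inj' hW2.ne'] at this

/-- smooth decreasing cutoff: `1` on `(-∞,0]`, `0` on `[1,∞)` -/
noncomputable def GG (s : ℝ) : ℝ := 1 - Real.smoothTransition s

lemma GG_c1 : ContDiff ℝ 1 GG := contDiff_const.sub (Real.smoothTransition.contDiff (n := 1))

lemma GG_anti : Antitone GG := fun _ _ h => sub_le_sub_left (Real.smoothTransition.monotone h) _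

lemma GG_zero {s : ℝ} (h : 1 ≤ s) : GG s = 0 := by simp [GG, Real.smoothTransition.one_of_one_le h]

lemma GG_one {s : ℝ} (h : s ≤ 0) : GG s = 1 := by simp [GG, Real.smoothTransition.zero_of_nonpos h]

lemma GG_nonneg (s : ℝ) : 0 ≤ GG s := by
  have := Real.smoothTransition.le_one s
  unfold GG; linarith

lemma GG_le (s : ℝ) : GG s ≤ 1 := by
  have := Real.smoothTransition.nonneg s
  unfold GG; linarith

lemma dGG_nonpos (s : ℝ) : deriv GG s ≤ 0 := GG_anti.deriv_nonpos

lemma dGG_cont : Continuous (deriv GG) := GG_c1.continuous_deriv (by norm_num)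

lemma dGG_zero_left {s : ℝ} (h : s < 0) : deriv GG s = 0 := by
  have : GG =ᶠ[𝓝 s] fun _ => 1 := by
    filter_upwards [Iio_mem_nhds h] with y hy using GG_one (le_of_lt hy)
  rw [this.deriv_eq]; simp

lemma dGG_zero_right {s : ℝ} (h : 1 < s) : deriv GG s = 0 := by
  have : GG =ᶠ[𝓝 s] fun _ => 0 := by
    filter_upwards [Ioi_mem_nhds h] with y hy using GG_zero (le_of_lt hy)
  rw [this.deriv_eq]; simp

lemma dGG_bound : ∃ C : ℝ, 0 ≤ C ∧ ∀ s, |deriv GG s| ≤ C := by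
  obtain ⟨C, hC⟩ := (isCompact_Icc (a := (0:ℝ)) (b := 1)).exists_bound_of_continuousOn
    dGG_cont.continuousOn
  have hC0 : 0 ≤ C := (norm_nonneg _).trans (hC 0 (by simp))
  refine ⟨C, hC0, fun s => ?_⟩
  rcases lt_or_ge s 0 with h | h
  · simp [dGG_zero_left h, hC0]
  rcases lt_or_ge 1 s with h' | h'
  · simp [dGG_zero_right h', hC0]
  exact hC s ⟨h, h'⟩

/-- eventual vanishing near the boundary -/
lemma van {Ω : Set (ℝ × ℝ)} {ψ u : ℝ × ℝ → ℝ}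
    (hA : ∀ z, z ∉ Ω → z ∈ tsupport ψ → Tendsto u (𝓝[Ω] z) atTop) (n : ℝ) :
    ∀ z, z ∉ Ω → ∀ᶠ y in 𝓝[Ω] z, (ψ y = 0 ∧ fderiv ℝ ψ y = 0) ∨ n + 1 < u y := by
  intro z hz
  by_cases h : z ∈ tsupport ψ
  · filter_upwards [(hA z hz h).eventually_gt_atTop (n + 1)] with y hy using Or.inr hy
  · have h1 := notMem_tsupport_iff_eventuallyEq.1 h
    have h2 : ∀ᶠ y in 𝓝 z, fderiv ℝ ψ y = 0 := by
      filter_upwards [h1.fderiv (𝕜 := ℝ)] with y hy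
      rw [hy]
      exact congrFun fderiv_zero y
    filter_upwards [mem_nhdsWithin_of_mem_nhds h1, mem_nhdsWithin_of_mem_nhds h2] with y a b
      using Or.inl ⟨a, b⟩
 
lemma NN_cont {Ω : Set (ℝ × ℝ)} (hΩ : IsOpen Ω) {u₁ u₂ ψ : ℝ × ℝ → ℝ}
    (hu₁ : IsMSE u₁ Ω) (hu₂ : IsMSE u₂ Ω) (hψ : ContDiff ℝ 1 ψ) :
    ContinuousOn (NN ψ u₁ u₂) Ω ∧ ContinuousOn (TT u₁ u₂) Ω ∧ ContinuousOn (DD u₁ u₂) Ω := by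
  have a1 := (XX_c1 hΩ hu₁.1).1.continuousOn
  have a2 := (XX_c1 hΩ hu₁.1).2.continuousOn
  have b1 := (XX_c1 hΩ hu₂.1).1.continuousOn
  have b2 := (XX_c1 hΩ hu₂.1).2.continuousOn
  have p1 := (pd_c1 hΩ hu₁.1).1.continuousOn
  have p2 := (pd_c1 hΩ hu₁.1).2.continuousOn
  have q1 := (pd_c1 hΩ hu₂.1).1.continuousOn
  have q2 := (pd_c1 hΩ hu₂.1).2.continuousOn
  have hd : ∀ v : ℝ × ℝ, ContinuousOn (fun z => fderiv ℝ ψ z v) Ω := fun v =>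
    ((hψ.continuous_fderiv (by norm_num)).clm_apply continuous_const).continuousOn
  exact ⟨((hd _).mul (a1.sub b1)).add ((hd _).mul (a2.sub b2)),
    (p1.mul (a1.sub b1)).add (p2.mul (a2.sub b2)),
    ((p1.sub q1).mul (a1.sub b1)).add ((p2.sub q2).mul (a2.sub b2))⟩

lemma identity {Ω : Set (ℝ × ℝ)} (hΩ : IsOpen Ω) (hb : Bornology.IsBounded Ω)
    {u₁ u₂ ψ : ℝ × ℝ → ℝ} (hu₁ : IsMSE u₁ Ω) (hu₂ : IsMSE u₂ Ω) (hψ : ContDiff ℝ 1 ψ)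
    (hA : ∀ z, z ∉ Ω → z ∈ tsupport ψ → Tendsto u₁ (𝓝[Ω] z) atTop)
    {Φ : ℝ → ℝ} (hΦ : ContDiff ℝ 1 Φ) (n : ℝ) :
    IntegrableOn (fun z => GG (u₁ z - n) * Φ (u₁ z - u₂ z) * NN ψ u₁ u₂ z) Ω ∧
    IntegrableOn (fun z => ψ z * deriv GG (u₁ z - n) * Φ (u₁ z - u₂ z) * TT u₁ u₂ z) Ω ∧
    IntegrableOn (fun z => ψ z * GG (u₁ z - n) * deriv Φ (u₁ z - u₂ z) * DD u₁ u₂ z) Ω ∧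
    (∫ z in Ω, GG (u₁ z - n) * Φ (u₁ z - u₂ z) * NN ψ u₁ u₂ z) +
    (∫ z in Ω, ψ z * deriv GG (u₁ z - n) * Φ (u₁ z - u₂ z) * TT u₁ u₂ z) +
    (∫ z in Ω, ψ z * GG (u₁ z - n) * deriv Φ (u₁ z - u₂ z) * DD u₁ u₂ z) = 0 := by
  obtain ⟨cN, cT, cD⟩ := NN_cont hΩ hu₁ hu₂ hψ
  have hv := van hA n
  have c1 : ContDiffOn ℝ 1 u₁ Ω := hu₁.1.of_le (by norm_num)
  have c2 : ContDiffOn ℝ 1 u₂ Ω := hu₂.1.of_le (by norm_num)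
  have cG : ContDiffOn ℝ 1 (fun z => GG (u₁ z - n)) Ω :=
    GG_c1.comp_contDiffOn (c1.sub contDiffOn_const)
  have cΦ : ContDiffOn ℝ 1 (fun z => Φ (u₁ z - u₂ z)) Ω := hΦ.comp_contDiffOn (c1.sub c2)
  have cdG : ContinuousOn (fun z => deriv GG (u₁ z - n)) Ω :=
    dGG_cont.comp_continuousOn (c1.continuousOn.sub continuousOn_const)
  have cdΦ : ContinuousOn (fun z => deriv Φ (u₁ z - u₂ z)) Ω :=
    (hΦ.continuous_deriv (by norm_num)).comp_continuousOn (c1.continuousOn.sub c2.continuousOn)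
  have cψ : ContinuousOn ψ Ω := hψ.continuous.continuousOn
  have ia : IntegrableOn (fun z => GG (u₁ z - n) * Φ (u₁ z - u₂ z) * NN ψ u₁ u₂ z) Ω := by
    refine van_integrableOn hΩ hb ((cG.continuousOn.mul cΦ.continuousOn).mul cN) ?_
    intro z hz
    filter_upwards [hv z hz] with y hy
    rcases hy with ⟨h1, h2⟩ | h
    · simp [NN, h2]
    · simp [GG_zero (show 1 ≤ u₁ y - n by linarith)]
  have ib : IntegrableOn
      (fun z => ψ z * deriv GG (u₁ z - n) * Φ (u₁ z - u₂ z) * TT u₁ u₂ z) Ω := by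
    refine van_integrableOn hΩ hb (((cψ.mul cdG).mul cΦ.continuousOn).mul cT) ?_
    intro z hz
    filter_upwards [hv z hz] with y hy
    rcases hy with ⟨h1, h2⟩ | h
    · simp [h1]
    · simp [dGG_zero_right (show 1 < u₁ y - n by linarith)]
  have ic : IntegrableOn
      (fun z => ψ z * GG (u₁ z - n) * deriv Φ (u₁ z - u₂ z) * DD u₁ u₂ z) Ω := by
    refine van_integrableOn hΩ hb (((cψ.mul cG.continuousOn).mul cdΦ).mul cD) ?_
    intro z hz
    filter_upwards [hv z hz] with y hy
    rcases hy with ⟨h1, h2⟩ | h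
    · simp [h1]
    · simp [GG_zero (show 1 ≤ u₁ y - n by linarith)]
  refine ⟨ia, ib, ic, ?_⟩
  set η : ℝ × ℝ → ℝ := fun z => ψ z * GG (u₁ z - n) * Φ (u₁ z - u₂ z) with hη
  have cη : ContDiffOn ℝ 1 η Ω := (hψ.contDiffOn.mul cG).mul cΦ
  have vη : ∀ z, z ∉ Ω → ∀ᶠ z' in 𝓝[Ω] z, η z' = 0 := by
    intro z hz
    filter_upwards [hv z hz] with y hy
    rcases hy with ⟨h1, h2⟩ | h
    · simp [hη, h1]
    · simp [hη, GG_zero (show 1 ≤ u₁ y - n by linarith)]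
  obtain ⟨k1, l1⟩ := ibp hΩ hb hu₁ cη vη
  obtain ⟨k2, l2⟩ := ibp hΩ hb hu₂ cη vη
  have hsub := integral_sub k1 k2
  rw [l1, l2, sub_zero] at hsub
  have hadd := integral_add (ia.add ib) ic
  have hadd2 := integral_add ia ib
  simp only [Pi.add_apply] at hadd
  rw [← hadd2, ← hadd]
  refine Eq.trans (setIntegral_congr_fun hΩ.measurableSet ?_) hsub
  intro z hz
  have d1 : DifferentiableAt ℝ u₁ z :=
    (c1.contDiffAt (hΩ.mem_nhds hz)).differentiableAt (by norm_num)
  have d2 : DifferentiableAt ℝ u₂ z :=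
    (c2.contDiffAt (hΩ.mem_nhds hz)).differentiableAt (by norm_num)
  have dψ : DifferentiableAt ℝ ψ z := hψ.differentiable (by norm_num) z
  have hG : HasFDerivAt (fun z => GG (u₁ z - n)) (deriv GG (u₁ z - n) • fderiv ℝ u₁ z) z :=
    HasDerivAt.comp_hasFDerivAt (h₂ := GG) (f := fun z => u₁ z - n) z
      ((GG_c1.differentiable (by norm_num) (u₁ z - n)).hasDerivAt)
      (d1.hasFDerivAt.sub_const n)
  have hP : HasFDerivAt (fun z => Φ (u₁ z - u₂ z))
      (deriv Φ (u₁ z - u₂ z) • (fderiv ℝ u₁ z - fderiv ℝ u₂ z)) z :=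
    ((hΦ.differentiable (by norm_num) (u₁ z - u₂ z)).hasDerivAt).comp_hasFDerivAt z
      (d1.hasFDerivAt.sub d2.hasFDerivAt)
  have hE : HasFDerivAt η _ z := (dψ.hasFDerivAt.mul hG).mul hP
  simp only [hE.fderiv]
  simp only [_root_.add_apply, _root_.smul_apply, _root_.sub_apply, smul_eq_mul, NN, TT, DD,
    pd1_eq d1, pd2_eq d1, pd1_eq d2, pd2_eq d2, Pi.mul_apply]
  ring

lemma NN_bound {Ω : Set (ℝ × ℝ)} (hb : Bornology.IsBounded Ω)
    {u₁ u₂ ψ : ℝ × ℝ → ℝ} (hψ : ContDiff ℝ 1 ψ) :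
    ∃ C, ∀ z ∈ Ω, |NN ψ u₁ u₂ z| ≤ C := by
  have hd : ∀ v : ℝ × ℝ, Continuous (fun z => fderiv ℝ ψ z v) := fun v =>
    ((hψ.continuous_fderiv (by norm_num)).clm_apply continuous_const)
  obtain ⟨C1, h1⟩ := hb.isCompact_closure.exists_bound_of_continuousOn (hd (1, 0)).continuousOn
  obtain ⟨C2, h2⟩ := hb.isCompact_closure.exists_bound_of_continuousOn (hd (0, 1)).continuousOn
  refine ⟨C1 * 2 + C2 * 2, fun z hz => ?_⟩
  have a := h1 z (subset_closure hz)
  have b := h2 z (subset_closure hz)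
  rw [Real.norm_eq_abs] at a b
  have c : |XX u₁ z - XX u₂ z| ≤ 2 :=
    (abs_sub _ _).trans (by linarith [(XX_abs u₁ z).1, (XX_abs u₂ z).1])
  have d : |YY u₁ z - YY u₂ z| ≤ 2 :=
    (abs_sub _ _).trans (by linarith [(XX_abs u₁ z).2, (XX_abs u₂ z).2])
  unfold NN
  refine (abs_add_le _ _).trans ?_
  rw [abs_mul, abs_mul]
  gcongr
  · exact (abs_nonneg _).trans a
  · exact (abs_nonneg _).trans b

lemma lim_a {Ω : Set (ℝ × ℝ)} (hΩ : IsOpen Ω) (hb : Bornology.IsBounded Ω)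
    {u₁ u₂ ψ : ℝ × ℝ → ℝ} (hu₁ : IsMSE u₁ Ω) (hu₂ : IsMSE u₂ Ω) (hψ : ContDiff ℝ 1 ψ)
    {Φ : ℝ → ℝ} (hΦ : ContDiff ℝ 1 Φ) {M : ℝ} (hM : ∀ s, |Φ s| ≤ M) :
    Tendsto (fun n : ℕ => ∫ z in Ω, GG (u₁ z - n) * Φ (u₁ z - u₂ z) * NN ψ u₁ u₂ z) atTop
      (𝓝 (∫ z in Ω, Φ (u₁ z - u₂ z) * NN ψ u₁ u₂ z)) := by
  obtain ⟨cN, cT, cD⟩ := NN_cont hΩ hu₁ hu₂ hψ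
  obtain ⟨C, hC⟩ := NN_bound hb (u₁ := u₁) (u₂ := u₂) hψ
  have hM0 : 0 ≤ M := (abs_nonneg _).trans (hM 0)
  have c1 := hu₁.1.continuousOn
  have c2 := hu₂.1.continuousOn
  have cΦ : ContinuousOn (fun z => Φ (u₁ z - u₂ z)) Ω :=
    hΦ.continuous.comp_continuousOn (c1.sub c2)
  have hfin : IntegrableOn (fun _ : ℝ × ℝ => M * C) Ω :=
    integrableOn_const (hb.measure_lt_top.ne)
  refine tendsto_integral_of_dominated_convergence (fun _ => M * C) ?_ hfin ?_ ?_
  · intro n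
    have cG : ContinuousOn (fun z => GG (u₁ z - n)) Ω :=
      GG_c1.continuous.comp_continuousOn (c1.sub continuousOn_const)
    exact ((cG.mul cΦ).mul cN).aestronglyMeasurable hΩ.measurableSet
  · intro n
    filter_upwards [ae_restrict_mem hΩ.measurableSet] with z hz
    rw [Real.norm_eq_abs, abs_mul, abs_mul]
    have h1 : |GG (u₁ z - n)| ≤ 1 := by
      rw [abs_of_nonneg (GG_nonneg _)]; exact GG_le _
    have h2 : |GG (u₁ z - n)| * |Φ (u₁ z - u₂ z)| ≤ 1 * M := by
      gcongr; exact hM _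
    rw [one_mul] at h2
    gcongr
    exact hC z hz
  · filter_upwards [ae_restrict_mem hΩ.measurableSet] with z hz
    refine tendsto_const_nhds.congr' ?_
    filter_upwards [tendsto_natCast_atTop_atTop.eventually_ge_atTop (u₁ z)] with n hn
    rw [GG_one (by linarith), one_mul]

lemma lim_h {Ω : Set (ℝ × ℝ)} (hΩ : IsOpen Ω) (hb : Bornology.IsBounded Ω)
    {u₁ ψ : ℝ × ℝ → ℝ} (hu₁ : IsMSE u₁ Ω) (hψ : ContDiff ℝ 1 ψ) :
    (∀ n : ℕ, IntegrableOn (fun z => ψ z * deriv GG (u₁ z - n)) Ω) ∧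
    Tendsto (fun n : ℕ => ∫ z in Ω, ψ z * deriv GG (u₁ z - n)) atTop (𝓝 0) := by
  obtain ⟨C, hC0, hC⟩ := dGG_bound
  obtain ⟨D, hD⟩ := hb.isCompact_closure.exists_bound_of_continuousOn hψ.continuous.continuousOn
  have c1 := hu₁.1.continuousOn
  have hfin : IntegrableOn (fun _ : ℝ × ℝ => D * C) Ω :=
    integrableOn_const (hb.measure_lt_top.ne)
  have hm : ∀ n : ℕ, AEStronglyMeasurable (fun z => ψ z * deriv GG (u₁ z - n))
      (volume.restrict Ω) := by
    intro n
    have cG : ContinuousOn (fun z => deriv GG (u₁ z - n)) Ω :=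
      dGG_cont.comp_continuousOn (c1.sub continuousOn_const)
    exact (hψ.continuous.continuousOn.mul cG).aestronglyMeasurable hΩ.measurableSet
  have hbd : ∀ n : ℕ, ∀ᵐ z ∂(volume.restrict Ω), ‖ψ z * deriv GG (u₁ z - n)‖ ≤ D * C := by
    intro n
    filter_upwards [ae_restrict_mem hΩ.measurableSet] with z hz
    have a := hD z (subset_closure hz)
    rw [norm_mul]
    have b := hC (u₁ z - n)
    rw [← Real.norm_eq_abs] at b
    have : 0 ≤ D := (norm_nonneg _).trans a
    gcongr
  refine ⟨fun n => Integrable.mono' hfin (hm n) (hbd n), ?_⟩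
  have : (0 : ℝ) = ∫ z in Ω, (fun _ : ℝ × ℝ => (0 : ℝ)) z := by simp
  rw [this]
  refine tendsto_integral_of_dominated_convergence (fun _ => D * C) hm hfin hbd ?_
  filter_upwards [ae_restrict_mem hΩ.measurableSet] with z hz
  refine tendsto_const_nhds.congr' ?_
  filter_upwards [tendsto_natCast_atTop_atTop.eventually_gt_atTop (u₁ z)] with n hn
  rw [dGG_zero_left (by linarith), mul_zero]

/-- Step 1: nonnegativity of the flux difference. -/
lemma flux_nonneg {Ω : Set (ℝ × ℝ)} (hΩ : IsOpen Ω) (hb : Bornology.IsBounded Ω)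
    {u₁ u₂ ψ : ℝ × ℝ → ℝ} (hu₁ : IsMSE u₁ Ω) (hu₂ : IsMSE u₂ Ω) (hψ : ContDiff ℝ 1 ψ)
    (hψ0 : ∀ z, 0 ≤ ψ z)
    (hA : ∀ z, z ∉ Ω → z ∈ tsupport ψ → Tendsto u₁ (𝓝[Ω] z) atTop) :
    Tendsto (fun n : ℕ => ∫ z in Ω, ψ z * deriv GG (u₁ z - n) * TT u₁ u₂ z) atTop
      (𝓝 (-∫ z in Ω, NN ψ u₁ u₂ z)) ∧
    (∀ n : ℕ, IntegrableOn (fun z => ψ z * deriv GG (u₁ z - n) * TT u₁ u₂ z) Ω) ∧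
    0 ≤ ∫ z in Ω, NN ψ u₁ u₂ z := by
  have hid := fun n : ℕ => identity hΩ hb hu₁ hu₂ hψ hA (Φ := fun _ => (1 : ℝ)) contDiff_const n
  have hlim := lim_a hΩ hb hu₁ hu₂ hψ (Φ := fun _ => (1 : ℝ)) contDiff_const (M := 1) (by simp)
  obtain ⟨hhi, hh⟩ := lim_h hΩ hb hu₁ hψ
  simp only [mul_one, one_mul, deriv_const, mul_zero, zero_mul, integral_zero, add_zero] at hid hlim
  have hl : Tendsto (fun n : ℕ => ∫ z in Ω, ψ z * deriv GG (u₁ z - n) * TT u₁ u₂ z) atTop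
      (𝓝 (-∫ z in Ω, NN ψ u₁ u₂ z)) := by
    refine hlim.neg.congr fun n => ?_
    have := (hid n).2.2.2
    linarith
  refine ⟨hl, fun n => (hid n).2.1, ?_⟩
  have hle : ∀ n : ℕ, ∫ z in Ω, ψ z * deriv GG (u₁ z - n) * TT u₁ u₂ z ≤
      -∫ z in Ω, ψ z * deriv GG (u₁ z - n) := by
    intro n
    rw [← integral_neg]
    refine integral_mono (hid n).2.1 (hhi n).neg ?_
    intro z
    have h1 := TT_ge u₁ u₂ z
    have h2 : ψ z * deriv GG (u₁ z - n) ≤ 0 :=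
      mul_nonpos_of_nonneg_of_nonpos (hψ0 z) (dGG_nonpos _)
    simp only
    nlinarith
  have := le_of_tendsto_of_tendsto' hl hh.neg hle
  linarith

lemma NN_swap (ψ u₁ u₂ : ℝ × ℝ → ℝ) (z : ℝ × ℝ) : NN ψ u₂ u₁ z = -NN ψ u₁ u₂ z := by
  unfold NN; ring

lemma lim_b {Ω : Set (ℝ × ℝ)} (hΩ : IsOpen Ω) (hb : Bornology.IsBounded Ω)
    {u₁ u₂ ψ : ℝ × ℝ → ℝ} (hu₁ : IsMSE u₁ Ω) (hu₂ : IsMSE u₂ Ω) (hψ : ContDiff ℝ 1 ψ)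
    (hψ0 : ∀ z, 0 ≤ ψ z)
    (hA₁ : ∀ z, z ∉ Ω → z ∈ tsupport ψ → Tendsto u₁ (𝓝[Ω] z) atTop)
    (hA₂ : ∀ z, z ∉ Ω → z ∈ tsupport ψ → Tendsto u₂ (𝓝[Ω] z) atTop)
    {Φ : ℝ → ℝ} (hΦ : ContDiff ℝ 1 Φ) {M : ℝ} (hM : ∀ s, |Φ s| ≤ M) :
    Tendsto (fun n : ℕ => ∫ z in Ω, ψ z * deriv GG (u₁ z - n) * Φ (u₁ z - u₂ z) * TT u₁ u₂ z)
      atTop (𝓝 0) := by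
  obtain ⟨hl, hint, hpos⟩ := flux_nonneg hΩ hb hu₁ hu₂ hψ hψ0 hA₁
  obtain ⟨-, -, hpos'⟩ := flux_nonneg hΩ hb hu₂ hu₁ hψ hψ0 hA₂
  simp only [NN_swap ψ u₁ u₂, integral_neg] at hpos'
  have hI : ∫ z in Ω, NN ψ u₁ u₂ z = 0 := by linarith
  rw [hI, neg_zero] at hl
  obtain ⟨hhi, hh⟩ := lim_h hΩ hb hu₁ hψ
  have hM0 : 0 ≤ M := (abs_nonneg _).trans (hM 0)
  have hid := fun n : ℕ => identity hΩ hb hu₁ hu₂ hψ hA₁ hΦ n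
  have hg : Tendsto (fun n : ℕ => M * (-(∫ z in Ω, ψ z * deriv GG (u₁ z - n) * TT u₁ u₂ z) -
      2 * ∫ z in Ω, ψ z * deriv GG (u₁ z - n))) atTop (𝓝 0) := by
    have := (hl.neg.sub (hh.const_mul 2)).const_mul M
    simpa using this
  refine squeeze_zero_norm (fun n => ?_) hg
  have hneg : IntegrableOn (fun z => -(ψ z * deriv GG (u₁ z - n) * TT u₁ u₂ z)) Ω := (hint n).neg
  rw [← integral_const_mul, ← integral_neg, ← integral_sub hneg ((hhi n).const_mul 2),
    ← integral_const_mul]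
  refine norm_integral_le_of_norm_le ((hneg.sub ((hhi n).const_mul 2)).const_mul M) ?_
  refine Eventually.of_forall fun z => ?_
  have h1 := TT_ge u₁ u₂ z
  have h2 : ψ z * deriv GG (u₁ z - n) ≤ 0 :=
    mul_nonpos_of_nonneg_of_nonpos (hψ0 z) (dGG_nonpos _)
  have h3 : |TT u₁ u₂ z| ≤ TT u₁ u₂ z + 2 := abs_le.2 ⟨by linarith, by linarith⟩
  have h4 := hM (u₁ z - u₂ z)
  rw [Real.norm_eq_abs, abs_mul, abs_mul, abs_of_nonpos h2]
  calc -(ψ z * deriv GG (u₁ z - n)) * |Φ (u₁ z - u₂ z)| * |TT u₁ u₂ z|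
      ≤ -(ψ z * deriv GG (u₁ z - n)) * M * (TT u₁ u₂ z + 2) := by
        have : 0 ≤ -(ψ z * deriv GG (u₁ z - n)) := by linarith
        gcongr
    _ = _ := by ring

/-- Step 2. -/
lemma core {Ω : Set (ℝ × ℝ)} (hΩ : IsOpen Ω) (hb : Bornology.IsBounded Ω)
    {u₁ u₂ ψ : ℝ × ℝ → ℝ} (hu₁ : IsMSE u₁ Ω) (hu₂ : IsMSE u₂ Ω) (hψ : ContDiff ℝ 1 ψ)
    (hψ0 : ∀ z, 0 ≤ ψ z)
    (hA₁ : ∀ z, z ∉ Ω → z ∈ tsupport ψ → Tendsto u₁ (𝓝[Ω] z) atTop)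
    (hA₂ : ∀ z, z ∉ Ω → z ∈ tsupport ψ → Tendsto u₂ (𝓝[Ω] z) atTop)
    {K : Set (ℝ × ℝ)} (hK : IsCompact K) (hKΩ : K ⊆ Ω) :
    ∫ z in K, ψ z * (1 / (1 + (u₁ z - u₂ z) ^ 2)) * DD u₁ u₂ z ≤
      -∫ z in Ω, Real.arctan (u₁ z - u₂ z) * NN ψ u₁ u₂ z := by
  have hΦ : ContDiff ℝ 1 Real.arctan := Real.contDiff_arctan
  have hM : ∀ s, |Real.arctan s| ≤ 2 := fun s => abs_le.2
    ⟨by linarith [Real.neg_pi_div_two_lt_arctan s, Real.pi_le_four],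
      by linarith [Real.arctan_lt_pi_div_two s, Real.pi_le_four]⟩
  have hid := fun n : ℕ => identity hΩ hb hu₁ hu₂ hψ hA₁ hΦ n
  have la := lim_a hΩ hb hu₁ hu₂ hψ hΦ hM
  have lb := lim_b hΩ hb hu₁ hu₂ hψ hψ0 hA₁ hA₂ hΦ hM
  have hlim := (la.add lb).neg
  rw [add_zero] at hlim
  refine ge_of_tendsto hlim ?_
  obtain ⟨C, hC⟩ := hK.exists_bound_of_continuousOn (hu₁.1.continuousOn.mono hKΩ)
  filter_upwards [tendsto_natCast_atTop_atTop.eventually_ge_atTop C] with n hn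
  obtain ⟨-, -, ic, e⟩ := hid n
  have e' : -((∫ z in Ω, GG (u₁ z - n) * Real.arctan (u₁ z - u₂ z) * NN ψ u₁ u₂ z) +
    (∫ z in Ω, ψ z * deriv GG (u₁ z - n) * Real.arctan (u₁ z - u₂ z) * TT u₁ u₂ z)) =
    (∫ z in Ω, ψ z * GG (u₁ z - n) * deriv Real.arctan (u₁ z - u₂ z) * DD u₁ u₂ z) := by linarith
  rw [e']
  have hnn : ∀ z, 0 ≤ ψ z * GG (u₁ z - n) * deriv Real.arctan (u₁ z - u₂ z) * DD u₁ u₂ z := by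
    intro z
    have h1 : 0 ≤ deriv Real.arctan (u₁ z - u₂ z) := by
      rw [Real.deriv_arctan]; positivity
    have h2 := hψ0 z
    have h3 := GG_nonneg (u₁ z - n)
    have h4 := DD_nonneg u₁ u₂ z
    positivity
  refine le_trans (le_of_eq ?_) (setIntegral_mono_set ic (Eventually.of_forall hnn)
    (LE.le.eventuallyLE hKΩ))
  refine setIntegral_congr_fun hK.measurableSet fun z hz => ?_
  have := (le_abs_self _).trans (hC z hz)
  simp only [Real.deriv_arctan]
  rw [GG_one (by linarith), mul_one]

lemma pd1_neg (u : ℝ × ℝ → ℝ) : pd1 (fun z => -u z) = fun z => -pd1 u z := by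
  funext z; unfold pd1; exact deriv.fun_neg

lemma pd2_neg (u : ℝ × ℝ → ℝ) : pd2 (fun z => -u z) = fun z => -pd2 u z := by
  funext z; unfold pd2; exact deriv.fun_neg

lemma IsMSE_neg {u : ℝ × ℝ → ℝ} {Ω : Set (ℝ × ℝ)} (h : IsMSE u Ω) : IsMSE (fun z => -u z) Ω := by
  refine ⟨h.1.neg, fun z hz => ?_⟩
  have := h.2 z hz
  simp only [pd1_neg, pd2_neg]
  linear_combination -this

lemma XX_neg (u : ℝ × ℝ → ℝ) (z : ℝ × ℝ) :
    XX (fun z => -u z) z = -XX u z ∧ YY (fun z => -u z) z = -YY u z := by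
  simp only [XX, YY, Wg, pd1_neg, pd2_neg, neg_sq, neg_div, and_self]

lemma core_neg {Ω : Set (ℝ × ℝ)} (hΩ : IsOpen Ω) (hb : Bornology.IsBounded Ω)
    {u₁ u₂ ψ : ℝ × ℝ → ℝ} (hu₁ : IsMSE u₁ Ω) (hu₂ : IsMSE u₂ Ω) (hψ : ContDiff ℝ 1 ψ)
    (hψ0 : ∀ z, 0 ≤ ψ z)
    (hA₁ : ∀ z, z ∉ Ω → z ∈ tsupport ψ → Tendsto u₁ (𝓝[Ω] z) atBot)
    (hA₂ : ∀ z, z ∉ Ω → z ∈ tsupport ψ → Tendsto u₂ (𝓝[Ω] z) atBot)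
    {K : Set (ℝ × ℝ)} (hK : IsCompact K) (hKΩ : K ⊆ Ω) :
    ∫ z in K, ψ z * (1 / (1 + (u₁ z - u₂ z) ^ 2)) * DD u₁ u₂ z ≤
      -∫ z in Ω, Real.arctan (u₁ z - u₂ z) * NN ψ u₁ u₂ z := by
  have h := core hΩ hb (IsMSE_neg hu₁) (IsMSE_neg hu₂) hψ hψ0
    (fun z a b => tendsto_neg_atBot_atTop.comp (hA₁ z a b))
    (fun z a b => tendsto_neg_atBot_atTop.comp (hA₂ z a b)) hK hKΩ
  have e1 : ∀ z, DD (fun z => -u₁ z) (fun z => -u₂ z) z = DD u₁ u₂ z := by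
    intro z
    simp only [DD, (XX_neg _ z).1, (XX_neg _ z).2, pd1_neg, pd2_neg]; ring
  have e2 : ∀ z, NN ψ (fun z => -u₁ z) (fun z => -u₂ z) z = -NN ψ u₁ u₂ z := by
    intro z
    simp only [NN, (XX_neg _ z).1, (XX_neg _ z).2]; ring
  have e3 : ∀ z, -u₁ z - -u₂ z = -(u₁ z - u₂ z) := fun z => by ring
  simp only [e1, e2, e3, Real.arctan_neg, neg_sq, neg_mul_neg] at h
  exact h

lemma cutoff (V : Finset (ℝ × ℝ)) : ∃ C : ℝ, 0 ≤ C ∧ ∀ ε : ℝ, 0 < ε → ∃ ζ : ℝ × ℝ → ℝ,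
    ContDiff ℝ 1 ζ ∧ (∀ z, 0 ≤ ζ z) ∧ (∀ v ∈ V, v ∉ tsupport ζ) ∧
    (∀ z, (∀ v ∈ V, 2 * ε ≤ dist z v) → ζ z = 1) ∧
    Integrable (fun z => |fderiv ℝ ζ z (1, 0)| + |fderiv ℝ ζ z (0, 1)|) ∧
    ∫ z, (|fderiv ℝ ζ z (1, 0)| + |fderiv ℝ ζ z (0, 1)|) ≤ C * ε := by
  obtain ⟨M, hM0, hM⟩ := dGG_bound
  let β : ContDiffBump (0 : ℝ × ℝ) := ⟨1, 2, by norm_num, by norm_num⟩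
  have cβ : ContDiff ℝ 1 β := β.contDiff
  have dβ : ∀ v : ℝ × ℝ, Continuous (fun z => |fderiv ℝ β z v|) := fun v =>
    ((cβ.continuous_fderiv (by norm_num)).clm_apply continuous_const).abs
  have iβ : ∀ v : ℝ × ℝ, Integrable (fun z => |fderiv ℝ β z v|) := fun v =>
    (((cβ.continuous_fderiv (by norm_num)).clm_apply
      continuous_const).integrable_of_hasCompactSupport (β.hasCompactSupport.fderiv_apply ℝ v)).abs
  let J : ℝ × ℝ → ℝ := fun v => ∫ z, |fderiv ℝ β z v|
  have hJ : ∀ v, 0 ≤ J v := fun v => integral_nonneg fun z => abs_nonneg _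
  refine ⟨M * (V.card * J (1, 0)) + M * (V.card * J (0, 1)), by
    have := hJ (1, 0); have := hJ (0, 1); positivity, ?_⟩
  intro ε hε
  let S : ℝ × ℝ → ℝ := fun z => ∑ v ∈ V, β (ε⁻¹ • (z - v))
  have cS : ContDiff ℝ 1 S := by
    refine ContDiff.sum fun v _ => ?_
    have h : ContDiff ℝ 1 (fun z : ℝ × ℝ => ε⁻¹ • (z - v)) :=
      (contDiff_id.sub contDiff_const).const_smul ε⁻¹
    exact cβ.comp h
  let ζ : ℝ × ℝ → ℝ := fun z => GG (S z)
  have cζ : ContDiff ℝ 1 ζ := GG_c1.comp cS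
  have hdS : ∀ z e, fderiv ℝ S z e = ∑ v ∈ V, ε⁻¹ * fderiv ℝ β (ε⁻¹ • (z - v)) e := by
    intro z e
    have h1 : ∀ v ∈ V, HasFDerivAt (fun z => β (ε⁻¹ • (z - v)))
        ((fderiv ℝ β (ε⁻¹ • (z - v))).comp (ε⁻¹ • ContinuousLinearMap.id ℝ (ℝ × ℝ))) z := by
      intro v _
      have h2 : HasFDerivAt (fun z : ℝ × ℝ => ε⁻¹ • (z - v))
          (ε⁻¹ • ContinuousLinearMap.id ℝ (ℝ × ℝ)) z :=
        ((hasFDerivAt_id z).sub_const v).const_smul ε⁻¹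
      exact HasFDerivAt.comp (g := β) z
        (cβ.differentiable (by norm_num) _).hasFDerivAt h2
    have h3 : HasFDerivAt S _ z := HasFDerivAt.fun_sum h1
    rw [h3.fderiv]
    simp
  have hdζ : ∀ z e, |fderiv ℝ ζ z e| ≤ M * (ε⁻¹ * ∑ v ∈ V, |fderiv ℝ β (ε⁻¹ • (z - v)) e|) := by
    intro z e
    have h1 : HasFDerivAt ζ (deriv GG (S z) • fderiv ℝ S z) z :=
      HasDerivAt.comp_hasFDerivAt (h₂ := GG) (f := S) z
        (GG_c1.differentiable (by norm_num) _).hasDerivAt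
        (cS.differentiable (by norm_num) z).hasFDerivAt
    rw [h1.fderiv, _root_.smul_apply, smul_eq_mul, abs_mul, hdS, ← Finset.mul_sum, abs_mul,
      abs_of_pos (inv_pos.2 hε)]
    gcongr
    · exact hM _
    · exact Finset.abs_sum_le_sum_abs _ _
  have iv : ∀ e v, Integrable (fun z => |fderiv ℝ β (ε⁻¹ • (z - v)) e|) ∧
      ∫ z, |fderiv ℝ β (ε⁻¹ • (z - v)) e| = ε ^ 2 * J e := by
    intro e v
    constructor
    · exact ((iβ e).comp_smul (inv_pos.2 hε).ne').comp_sub_right v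
    · rw [integral_sub_right_eq_self (fun z => |fderiv ℝ β (ε⁻¹ • z) e|) v,
        Measure.integral_comp_smul volume (fun z => |fderiv ℝ β z e|) ε⁻¹]
      simp [J, abs_of_pos hε]
  have iR : ∀ e, Integrable (fun z => M * (ε⁻¹ * ∑ v ∈ V, |fderiv ℝ β (ε⁻¹ • (z - v)) e|)) :=
    fun e => ((integrable_finset_sum _ fun v _ => (iv e v).1).const_mul _).const_mul _
  have iL : ∀ e, Integrable (fun z => |fderiv ℝ ζ z e|) := by
    intro e
    refine (iR e).mono' ?_ ?_
    · exact ((cζ.continuous_fderiv (by norm_num)).clm_apply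
        continuous_const).abs.aestronglyMeasurable
    · refine Eventually.of_forall fun z => ?_
      rw [Real.norm_eq_abs, abs_abs]
      exact hdζ z e
  have bL : ∀ e, ∫ z, |fderiv ℝ ζ z e| ≤ M * (V.card * J e) * ε := by
    intro e
    refine (integral_mono (iL e) (iR e) fun z => hdζ z e).trans (le_of_eq ?_)
    rw [integral_const_mul, integral_const_mul, integral_finset_sum _ fun v _ => (iv e v).1]
    simp only [(iv e _).2, Finset.sum_const, nsmul_eq_mul]
    field_simp
  refine ⟨ζ, cζ, fun z => GG_nonneg _, ?_, ?_, (iL _).add (iL _), ?_⟩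
  · intro v hv
    rw [notMem_tsupport_iff_eventuallyEq]
    filter_upwards [Metric.closedBall_mem_nhds v hε] with z hz
    refine GG_zero ?_
    have h1 : β (ε⁻¹ • (z - v)) = 1 := by
      apply β.one_of_mem_closedBall
      show ε⁻¹ • (z - v) ∈ Metric.closedBall 0 1
      rw [mem_closedBall_zero_iff, norm_smul, norm_inv, Real.norm_eq_abs, abs_of_pos hε,
        ← dist_eq_norm, inv_mul_le_iff₀ hε, mul_one]
      exact hz
    rw [← h1]
    exact Finset.single_le_sum (f := fun v => β (ε⁻¹ • (z - v))) (fun _ _ => β.nonneg) hv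
  · intro z hz
    refine GG_one (le_of_eq ?_)
    refine Finset.sum_eq_zero fun v hv => ?_
    apply β.zero_of_le_dist
    show 2 ≤ _
    rw [dist_zero_right, norm_smul, norm_inv, Real.norm_eq_abs, abs_of_pos hε,
        ← dist_eq_norm, le_inv_mul_iff₀ hε, mul_comm]
    exact hz v hv
  · rw [integral_add (iL _) (iL _), add_mul]
    exact add_le_add (bL _) (bL _)

lemma arcNN_integrable {Ω : Set (ℝ × ℝ)} (hΩ : IsOpen Ω) (hb : Bornology.IsBounded Ω)
    {u₁ u₂ ψ : ℝ × ℝ → ℝ} (hu₁ : IsMSE u₁ Ω) (hu₂ : IsMSE u₂ Ω) (hψ : ContDiff ℝ 1 ψ) :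
    IntegrableOn (fun z => Real.arctan (u₁ z - u₂ z) * NN ψ u₁ u₂ z) Ω := by
  obtain ⟨cN, -, -⟩ := NN_cont hΩ hu₁ hu₂ hψ
  obtain ⟨C, hC⟩ := NN_bound hb (u₁ := u₁) (u₂ := u₂) hψ
  have hfin : IntegrableOn (fun _ : ℝ × ℝ => 2 * C) Ω :=
    integrableOn_const (hb.measure_lt_top.ne)
  refine Integrable.mono' hfin ?_ ?_
  · exact ((Real.continuous_arctan.comp_continuousOn
      (hu₁.1.continuousOn.sub hu₂.1.continuousOn)).mul cN).aestronglyMeasurable hΩ.measurableSet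
  · filter_upwards [ae_restrict_mem hΩ.measurableSet] with z hz
    rw [norm_mul]
    have a : ‖Real.arctan (u₁ z - u₂ z)‖ ≤ 2 := abs_le.2
      ⟨by linarith [Real.neg_pi_div_two_lt_arctan (u₁ z - u₂ z), Real.pi_le_four],
      by linarith [Real.arctan_lt_pi_div_two (u₁ z - u₂ z), Real.pi_le_four]⟩
    have b := hC z hz
    rw [← Real.norm_eq_abs] at b
    gcongr

lemma arcNN_bound {Ω : Set (ℝ × ℝ)} (hΩ : IsOpen Ω) (hb : Bornology.IsBounded Ω)
    {u₁ u₂ ζ : ℝ × ℝ → ℝ} (hu₁ : IsMSE u₁ Ω) (hu₂ : IsMSE u₂ Ω) (hζ : ContDiff ℝ 1 ζ)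
    (hi : Integrable (fun z => |fderiv ℝ ζ z (1, 0)| + |fderiv ℝ ζ z (0, 1)|)) :
    -∫ z in Ω, Real.arctan (u₁ z - u₂ z) * NN ζ u₁ u₂ z ≤
      4 * ∫ z, (|fderiv ℝ ζ z (1, 0)| + |fderiv ℝ ζ z (0, 1)|) := by
  rw [← integral_neg, ← integral_const_mul]
  have h1 : ∫ z in Ω, 4 * (|fderiv ℝ ζ z (1, 0)| + |fderiv ℝ ζ z (0, 1)|) ≤
      ∫ z, 4 * (|fderiv ℝ ζ z (1, 0)| + |fderiv ℝ ζ z (0, 1)|) :=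
    setIntegral_le_integral (hi.const_mul 4) (Eventually.of_forall fun z => by
      show 0 ≤ _; positivity)
  refine le_trans (integral_mono (arcNN_integrable hΩ hb hu₁ hu₂ hζ).neg
    (hi.const_mul 4).integrableOn fun z => ?_) h1
  refine (le_abs_self _).trans ?_
  simp only [Pi.neg_apply, abs_neg, abs_mul]
  have a : |Real.arctan (u₁ z - u₂ z)| ≤ 2 := abs_le.2
      ⟨by linarith [Real.neg_pi_div_two_lt_arctan (u₁ z - u₂ z), Real.pi_le_four],
      by linarith [Real.arctan_lt_pi_div_two (u₁ z - u₂ z), Real.pi_le_four]⟩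
  have c : |XX u₁ z - XX u₂ z| ≤ 2 :=
    (abs_sub _ _).trans (by linarith [(XX_abs u₁ z).1, (XX_abs u₂ z).1])
  have d : |YY u₁ z - YY u₂ z| ≤ 2 :=
    (abs_sub _ _).trans (by linarith [(XX_abs u₁ z).2, (XX_abs u₂ z).2])
  have b : |NN ζ u₁ u₂ z| ≤ |fderiv ℝ ζ z (1, 0)| * 2 + |fderiv ℝ ζ z (0, 1)| * 2 := by
    unfold NN
    refine (abs_add_le _ _).trans ?_
    rw [abs_mul, abs_mul]
    gcongr
  calc |Real.arctan (u₁ z - u₂ z)| * |NN ζ u₁ u₂ z|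
      ≤ 2 * (|fderiv ℝ ζ z (1, 0)| * 2 + |fderiv ℝ ζ z (0, 1)| * 2) := by gcongr
    _ = _ := by ring

lemma seg_cases {a b z : ℝ × ℝ} (h : z ∈ segment ℝ a b) :
    z = a ∨ z = b ∨ z ∈ openSegment ℝ a b := by
  rw [← insert_endpoints_openSegment] at h
  simpa using h

/-- Pointwise vanishing of `DD`. -/
lemma DD_vanish
    (Ω : Set (ℝ × ℝ)) (hΩo : IsOpen Ω) (hΩb : Bornology.IsBounded Ω)
    (V : Finset (ℝ × ℝ)) (hV : ∀ v ∈ V, v ∉ Ω) (FA FB : Set (ℝ × ℝ))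
    (hFA : IsClosed FA) (hFB : IsClosed FB) (hbd : frontier Ω ⊆ FA ∪ FB)
    (hAB : ∀ z ∈ FA, z ∈ FB → z ∈ V)
    (u₁ u₂ : ℝ × ℝ → ℝ) (hu₁ : IsMSE u₁ Ω) (hu₂ : IsMSE u₂ Ω)
    (hA₁ : ∀ z ∈ FA, z ∉ V → Tendsto u₁ (𝓝[Ω] z) atTop)
    (hA₂ : ∀ z ∈ FA, z ∉ V → Tendsto u₂ (𝓝[Ω] z) atTop)
    (hB₁ : ∀ z ∈ FB, z ∉ V → Tendsto u₁ (𝓝[Ω] z) atBot)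
    (hB₂ : ∀ z ∈ FB, z ∉ V → Tendsto u₂ (𝓝[Ω] z) atBot) :
    ∀ z ∈ Ω, DD u₁ u₂ z = 0 := by
  intro z₀ hz₀
  by_contra hne
  have hpos : 0 < DD u₁ u₂ z₀ := lt_of_le_of_ne (DD_nonneg _ _ _) (Ne.symm hne)
  set f : ℝ × ℝ → ℝ := fun z => (1 / (1 + (u₁ z - u₂ z) ^ 2)) * DD u₁ u₂ z with hf
  have c1 := hu₁.1.continuousOn
  have c2 := hu₂.1.continuousOn
  have cD := (NN_cont hΩo hu₁ hu₂ (contDiff_const (c := (0 : ℝ)))).2.2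
  have cf : ContinuousOn f Ω := by
    refine ContinuousOn.mul (ContinuousOn.div continuousOn_const
      (continuousOn_const.add ((c1.sub c2).pow 2)) fun z _ => by positivity) cD
  have hf0 : 0 < f z₀ := by
    have : 0 < 1 / (1 + (u₁ z₀ - u₂ z₀) ^ 2) := by positivity
    exact mul_pos this hpos
  have hev : ∀ᶠ z in 𝓝 z₀, z ∈ Ω ∧ f z₀ / 2 < f z :=
    (hΩo.eventually_mem hz₀).and ((cf.continuousAt (hΩo.mem_nhds hz₀)).eventually_const_lt
      (half_lt_self hf0))
  obtain ⟨R, hR, hball⟩ := Metric.eventually_nhds_iff.1 hev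
  set r := R / 3 with hr
  have hr0 : 0 < r := by positivity
  set K := Metric.closedBall z₀ r with hKdef
  have hK : IsCompact K := isCompact_closedBall z₀ r
  have hKΩ : K ⊆ Ω := fun z hz => (hball (lt_of_le_of_lt hz (by linarith))).1
  have hvol : 0 < (volume K).toReal :=
    ENNReal.toReal_pos (Metric.measure_closedBall_pos volume z₀ hr0).ne' hK.measure_lt_top.ne
  have ifK : IntegrableOn f K := (cf.mono hKΩ).integrableOn_compact hK
  have hL : 0 < ∫ z in K, f z := by
    have h1 : ∫ z in K, (f z₀ / 2) ≤ ∫ z in K, f z :=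
      setIntegral_mono_on (integrableOn_const hK.measure_lt_top.ne) ifK hK.measurableSet
        fun z hz => (hball (lt_of_le_of_lt hz (by linarith))).2.le
    rw [setIntegral_const, smul_eq_mul] at h1
    have : 0 < volume.real K * (f z₀ / 2) := mul_pos hvol (by linarith)
    linarith
  set L := ∫ z in K, f z with hLdef
  obtain ⟨C, hC0, hC⟩ := cutoff V
  set ε := min (r / 2) (L / (8 * (C + 1))) with hε
  have hε0 : 0 < ε := lt_min (by positivity) (by positivity)
  obtain ⟨ζ, cζ, ζ0, ζV, ζ1, ζi, ζb⟩ := hC ε hε0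
  have ζK : ∀ z ∈ K, ζ z = 1 := by
    intro z hz
    refine ζ1 z fun v hv => ?_
    by_contra hlt
    push Not at hlt
    have h1 : ε ≤ r / 2 := min_le_left _ _
    refine hV v hv (hball ?_).1
    have h2 : dist z z₀ ≤ r := hz
    have h3 := dist_triangle v z z₀
    rw [dist_comm v z] at h3
    linarith
  -- separate the two kinds of sides
  have hdisj : Disjoint (FB ∩ tsupport ζ) (FA ∩ tsupport ζ) := by
    rw [Set.disjoint_left]
    rintro z ⟨hzB, hzs⟩ ⟨hzA, -⟩
    exact ζV z (hAB z hzA hzB) hzs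
  obtain ⟨ξ, hξB, hξA, hξ01⟩ := exists_contMDiffMap_zero_one_nhds_of_isClosed
    (n := 1) (modelWithCornersSelf ℝ (ℝ × ℝ)) (hFB.inter (isClosed_tsupport ζ))
    (hFA.inter (isClosed_tsupport ζ)) hdisj
  have cξ : ContDiff ℝ 1 ξ := ξ.contMDiff.contDiff
  set ψA : ℝ × ℝ → ℝ := fun z => ζ z * ξ z with hψA
  set ψB : ℝ × ℝ → ℝ := fun z => ζ z * (1 - ξ z) with hψB
  have cA : ContDiff ℝ 1 ψA := cζ.mul cξ
  have cB : ContDiff ℝ 1 ψB := cζ.mul (contDiff_const.sub cξ)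
  have A0 : ∀ z, 0 ≤ ψA z := fun z => mul_nonneg (ζ0 z) (hξ01 z).1
  have B0 : ∀ z, 0 ≤ ψB z := fun z => mul_nonneg (ζ0 z) (sub_nonneg.2 (hξ01 z).2)
  have hsA : tsupport ψA ⊆ tsupport ζ := tsupport_mul_subset_left
  have hsB : tsupport ψB ⊆ tsupport ζ := tsupport_mul_subset_left
  have hAcase : ∀ z, z ∉ Ω → z ∈ tsupport ψA → (𝓝[Ω] z = ⊥) ∨ (z ∈ FA ∧ z ∉ V) := by
    intro z hz hzs
    by_cases hcl : z ∈ closure Ω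
    · right
      have hzf : z ∈ frontier Ω := by
        rw [hΩo.frontier_eq]; exact ⟨hcl, hz⟩
      refine ⟨?_, fun hv => ζV z hv (hsA hzs)⟩
      rcases hbd hzf with h | h
      · exact h
      · exfalso
        have hn := (Filter.eventually_of_mem (nhds_le_nhdsSet
          (show z ∈ FB ∩ tsupport ζ from ⟨h, hsA hzs⟩) hξB) fun y hy => hy)
        refine notMem_tsupport_iff_eventuallyEq.2 ?_ hzs
        filter_upwards [hn] with y hy
        have hy' : ξ y = 0 := hy
        simp [hψA, hy']
    · left
      exact notMem_closure_iff_nhdsWithin_eq_bot.1 hcl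
  have hBcase : ∀ z, z ∉ Ω → z ∈ tsupport ψB → (𝓝[Ω] z = ⊥) ∨ (z ∈ FB ∧ z ∉ V) := by
    intro z hz hzs
    by_cases hcl : z ∈ closure Ω
    · right
      have hzf : z ∈ frontier Ω := by
        rw [hΩo.frontier_eq]; exact ⟨hcl, hz⟩
      refine ⟨?_, fun hv => ζV z hv (hsB hzs)⟩
      rcases hbd hzf with h | h
      · exfalso
        have hn := (Filter.eventually_of_mem (nhds_le_nhdsSet
          (show z ∈ FA ∩ tsupport ζ from ⟨h, hsB hzs⟩) hξA) fun y hy => hy)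
        refine notMem_tsupport_iff_eventuallyEq.2 ?_ hzs
        filter_upwards [hn] with y hy
        have hy' : ξ y = 1 := hy
        simp [hψB, hy']
      · exact h
    · left
      exact notMem_closure_iff_nhdsWithin_eq_bot.1 hcl
  have kA := core hΩo hΩb hu₁ hu₂ cA A0
    (fun z a b => by
      rcases hAcase z a b with h | ⟨h, h'⟩
      · rw [h]; exact tendsto_bot
      · exact hA₁ z h h')
    (fun z a b => by
      rcases hAcase z a b with h | ⟨h, h'⟩
      · rw [h]; exact tendsto_bot
      · exact hA₂ z h h') hK hKΩ
  have kB := core_neg hΩo hΩb hu₁ hu₂ cB B0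
    (fun z a b => by
      rcases hBcase z a b with h | ⟨h, h'⟩
      · rw [h]; exact tendsto_bot
      · exact hB₁ z h h')
    (fun z a b => by
      rcases hBcase z a b with h | ⟨h, h'⟩
      · rw [h]; exact tendsto_bot
      · exact hB₂ z h h') hK hKΩ
  -- add the two
  have hNN : ∀ z, NN ζ u₁ u₂ z = NN ψA u₁ u₂ z + NN ψB u₁ u₂ z := by
    intro z
    have e : ζ = fun z => ψA z + ψB z := by funext z; simp only [hψA, hψB]; ring
    have e2 : fderiv ℝ ζ z = fderiv ℝ ψA z + fderiv ℝ ψB z := by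
      conv_lhs => rw [e]
      exact fderiv_fun_add (cA.differentiable (by norm_num) z) (cB.differentiable (by norm_num) z)
    simp only [NN, e2, _root_.add_apply]
    ring
  have hR : ∫ z in Ω, Real.arctan (u₁ z - u₂ z) * NN ζ u₁ u₂ z =
      (∫ z in Ω, Real.arctan (u₁ z - u₂ z) * NN ψA u₁ u₂ z) +
      ∫ z in Ω, Real.arctan (u₁ z - u₂ z) * NN ψB u₁ u₂ z := by
    rw [← integral_add (arcNN_integrable hΩo hΩb hu₁ hu₂ cA)
      (arcNN_integrable hΩo hΩb hu₁ hu₂ cB)]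
    simp only [hNN, mul_add]
  have hLsum : L = (∫ z in K, ψA z * (1 / (1 + (u₁ z - u₂ z) ^ 2)) * DD u₁ u₂ z) +
      ∫ z in K, ψB z * (1 / (1 + (u₁ z - u₂ z) ^ 2)) * DD u₁ u₂ z := by
    have iA : IntegrableOn (fun z => ψA z * (1 / (1 + (u₁ z - u₂ z) ^ 2)) * DD u₁ u₂ z) K := by
      have : IntegrableOn (fun z => ψA z * f z) K :=
        (cA.continuous.continuousOn.mul (cf.mono hKΩ)).integrableOn_compact hK
      simpa only [hf, mul_assoc] using this
    have iB : IntegrableOn (fun z => ψB z * (1 / (1 + (u₁ z - u₂ z) ^ 2)) * DD u₁ u₂ z) K := by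
      have : IntegrableOn (fun z => ψB z * f z) K :=
        (cB.continuous.continuousOn.mul (cf.mono hKΩ)).integrableOn_compact hK
      simpa only [hf, mul_assoc] using this
    rw [← integral_add iA iB, hLdef]
    refine setIntegral_congr_fun hK.measurableSet fun z hz => ?_
    simp only [hf, hψA, hψB, ζK z hz]
    ring
  have hbound := arcNN_bound hΩo hΩb hu₁ hu₂ cζ ζi
  have h1 : L ≤ 4 * (C * ε) := by linarith
  have h2 : ε ≤ L / (8 * (C + 1)) := min_le_right _ _
  have h3 : 4 * (C * ε) < L := by
    have : C * ε ≤ (C + 1) * ε := by nlinarith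
    have h4 : (C + 1) * ε ≤ L / 8 := by
      rw [le_div_iff₀ (by positivity)] at h2
      linarith
    linarith
  linarith

/-- Uniqueness up to an additive constant for the Jenkins–Serrin problem with only
infinite boundary data: if the boundary of the bounded simply connected open set `Ω`
is a polygon made of the open segments `A₁,…,A_k`, `B₁,…,B_l` and their endpoints, and
`u₁, u₂` are solutions of the minimal surfaces equation with boundary value `+∞` on
each `A_j` and `−∞` on each `B_j`, then `u₁ − u₂` is constant on `Ω`. -/
theorem jenkins_serrin_uniqueness_up_to_constant
    (Ω : Set (ℝ × ℝ)) (hΩo : IsOpen Ω) (hΩb : Bornology.IsBounded Ω)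
    (hΩne : Ω.Nonempty) (hΩsc : SimplyConnectedSpace ↥Ω)
    (k l : ℕ)
    (A : Fin k → (ℝ × ℝ) × (ℝ × ℝ)) (B : Fin l → (ℝ × ℝ) × (ℝ × ℝ))
    (hAnd : ∀ j, (A j).1 ≠ (A j).2) (hBnd : ∀ j, (B j).1 ≠ (B j).2)
    (hbd : frontier Ω =
      (⋃ j, segment ℝ (A j).1 (A j).2) ∪ ⋃ j, segment ℝ (B j).1 (B j).2)
    (hAA : ∀ j j', j ≠ j' →
      Disjoint (openSegment ℝ (A j).1 (A j).2) (openSegment ℝ (A j').1 (A j').2))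
    (hBB : ∀ j j', j ≠ j' →
      Disjoint (openSegment ℝ (B j).1 (B j).2) (openSegment ℝ (B j').1 (B j').2))
    (hAB : ∀ j j',
      Disjoint (openSegment ℝ (A j).1 (A j).2) (openSegment ℝ (B j').1 (B j').2))
    (u₁ u₂ : ℝ × ℝ → ℝ) (hu₁ : IsMSE u₁ Ω) (hu₂ : IsMSE u₂ Ω)
    (hA₁ : ∀ j, ∀ z ∈ openSegment ℝ (A j).1 (A j).2, Tendsto u₁ (𝓝[Ω] z) atTop)
    (hA₂ : ∀ j, ∀ z ∈ openSegment ℝ (A j).1 (A j).2, Tendsto u₂ (𝓝[Ω] z) atTop)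
    (hB₁ : ∀ j, ∀ z ∈ openSegment ℝ (B j).1 (B j).2, Tendsto u₁ (𝓝[Ω] z) atBot)
    (hB₂ : ∀ j, ∀ z ∈ openSegment ℝ (B j).1 (B j).2, Tendsto u₂ (𝓝[Ω] z) atBot) :
    ∃ c : ℝ, ∀ z ∈ Ω, u₁ z = u₂ z + c := by
  classical
  let V : Finset (ℝ × ℝ) :=
    (Finset.univ.image (fun j => (A j).1) ∪ Finset.univ.image (fun j => (A j).2)) ∪
    (Finset.univ.image (fun j => (B j).1) ∪ Finset.univ.image (fun j => (B j).2))
  have VA1 : ∀ j, (A j).1 ∈ V := fun j => by simp [V]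
  have VA2 : ∀ j, (A j).2 ∈ V := fun j => by simp [V]
  have VB1 : ∀ j, (B j).1 ∈ V := fun j => by simp [V]
  have VB2 : ∀ j, (B j).2 ∈ V := fun j => by simp [V]
  set FA : Set (ℝ × ℝ) := ⋃ j, segment ℝ (A j).1 (A j).2 with hFA
  set FB : Set (ℝ × ℝ) := ⋃ j, segment ℝ (B j).1 (B j).2 with hFB
  have segc : ∀ a b : ℝ × ℝ, IsClosed (segment ℝ a b) := by
    intro a b
    rw [← Path.range_segment]
    exact (isCompact_range (Path.segment a b).continuous).isClosed
  have cFA : IsClosed FA := isClosed_iUnion_of_finite fun j => segc _ _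
  have cFB : IsClosed FB := isClosed_iUnion_of_finite fun j => segc _ _
  have hfr : ∀ z ∈ FA ∪ FB, z ∉ Ω := by
    intro z hz
    rw [← hbd, hΩo.frontier_eq] at hz
    exact hz.2
  have hVΩ : ∀ v ∈ V, v ∉ Ω := by
    intro v hv
    apply hfr
    simp only [V, Finset.mem_union, Finset.mem_image, Finset.mem_univ, true_and] at hv
    rcases hv with (⟨j, rfl⟩ | ⟨j, rfl⟩) | (⟨j, rfl⟩ | ⟨j, rfl⟩)
    · exact Or.inl (mem_iUnion.2 ⟨j, left_mem_segment ℝ _ _⟩)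
    · exact Or.inl (mem_iUnion.2 ⟨j, right_mem_segment ℝ _ _⟩)
    · exact Or.inr (mem_iUnion.2 ⟨j, left_mem_segment ℝ _ _⟩)
    · exact Or.inr (mem_iUnion.2 ⟨j, right_mem_segment ℝ _ _⟩)
  have openA : ∀ z ∈ FA, z ∉ V → ∃ j, z ∈ openSegment ℝ (A j).1 (A j).2 := by
    intro z hz hzV
    obtain ⟨j, hj⟩ := mem_iUnion.1 hz
    rcases seg_cases hj with h | h | h
    · exact absurd (h ▸ VA1 j) hzV
    · exact absurd (h ▸ VA2 j) hzV
    · exact ⟨j, h⟩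
  have openB : ∀ z ∈ FB, z ∉ V → ∃ j, z ∈ openSegment ℝ (B j).1 (B j).2 := by
    intro z hz hzV
    obtain ⟨j, hj⟩ := mem_iUnion.1 hz
    rcases seg_cases hj with h | h | h
    · exact absurd (h ▸ VB1 j) hzV
    · exact absurd (h ▸ VB2 j) hzV
    · exact ⟨j, h⟩
  have hDD := DD_vanish Ω hΩo hΩb V hVΩ FA FB cFA cFB hbd.le
    (by
      intro z hzA hzB
      by_contra hzV
      obtain ⟨j, hj⟩ := openA z hzA hzV
      obtain ⟨j', hj'⟩ := openB z hzB hzV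
      exact Set.disjoint_left.1 (hAB j j') hj hj')
    u₁ u₂ hu₁ hu₂
    (fun z hz hzV => by obtain ⟨j, hj⟩ := openA z hz hzV; exact hA₁ j z hj)
    (fun z hz hzV => by obtain ⟨j, hj⟩ := openA z hz hzV; exact hA₂ j z hj)
    (fun z hz hzV => by obtain ⟨j, hj⟩ := openB z hz hzV; exact hB₁ j z hj)
    (fun z hz hzV => by obtain ⟨j, hj⟩ := openB z hz hzV; exact hB₂ j z hj)
  have hconn : IsPreconnected Ω := by
    have : PathConnectedSpace ↥Ω := inferInstance
    exact (isPathConnected_iff_pathConnectedSpace.2 this).isConnected.isPreconnected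
  have hd₁ : ∀ z ∈ Ω, DifferentiableAt ℝ u₁ z := fun z hz =>
    (hu₁.1.contDiffAt (hΩo.mem_nhds hz)).differentiableAt (by norm_num)
  have hd₂ : ∀ z ∈ Ω, DifferentiableAt ℝ u₂ z := fun z hz =>
    (hu₂.1.contDiffAt (hΩo.mem_nhds hz)).differentiableAt (by norm_num)
  obtain ⟨c, hc⟩ := hΩo.exists_is_const_of_fderiv_eq_zero (𝕜 := ℝ) (f := fun z => u₁ z - u₂ z) hconn
    (fun z hz => ((hd₁ z hz).sub (hd₂ z hz)).differentiableWithinAt)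
    (fun z hz => by
      obtain ⟨h1, h2⟩ := DD_zero (hDD z hz)
      rw [pd1_eq (hd₁ z hz), pd1_eq (hd₂ z hz)] at h1
      rw [pd2_eq (hd₁ z hz), pd2_eq (hd₂ z hz)] at h2
      rw [fderiv_fun_sub (hd₁ z hz) (hd₂ z hz)]
      ext
      · simpa [sub_eq_zero] using h1
      · simpa [sub_eq_zero] using h2)
  exact ⟨c, fun z hz => by linarith [hc z hz]⟩
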